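/- For any integer j ≥ 1 and all η ≥ 0, f_{2j}(η) = ∑_{k=0}^∞ (−1)^k Γ((k+j)/2) / (2^{2k+j+1} · k! · (k+j−1)!) · η^{2k}. For any integer j ≥ 0 and all η ≥ 0, f_{2j+1}(η) = (2^j/√(8π)) ∑_{k=0}^∞ (−1)^k (k+j)! Γ((2k+2j+1)/4) / (k! · (2k+2j)!) · η^{2k}. In particular the limit f_n(0) := lim_{η→0^+} f_n(η) exists and is strictly positive for every n ≥ 1. -/

import Mathlib

open MeasureTheory Real Filter Topology

noncomputable def besselJ (ν y : ℝ) : ℝ :=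
  ∑' k : ℕ, (-1 : ℝ) ^ k * (y / 2) ^ ((2 * k : ℝ) + ν) /
    (Nat.factorial k * Real.Gamma ((k : ℝ) + ν + 1))

noncomputable def fmn (m n : ℕ) (η : ℝ) : ℝ :=
  η ^ ((1 : ℝ) - n) *
    ∫ s in Set.Ioi (0 : ℝ),
      Real.exp (-(s ^ (2 * m))) * (η * s) ^ ((n : ℝ) / 2) *
        besselJ (((n : ℝ) - 2) / 2) (η * s)


/-- Coefficients of the power series, for general `n`. -/
noncomputable def coefA (n k : ℕ) : ℝ :=
  (-1 : ℝ) ^ k * (2:ℝ) ^ (-((2 * k : ℝ) + ((n : ℝ) - 2) / 2)) /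
    (Nat.factorial k * Real.Gamma ((k : ℝ) + ((n : ℝ) - 2) / 2 + 1))

noncomputable def coefC (n k : ℕ) : ℝ :=
  coefA n k * (1 / 4 * Real.Gamma ((2 * (k:ℝ) + n - 1 + 1) / 4))

lemma gamma_den_pos (n k : ℕ) (hn : 1 ≤ n) :
    0 < Real.Gamma ((k : ℝ) + ((n : ℝ) - 2) / 2 + 1) := by
  apply Real.Gamma_pos_of_pos
  have : (1:ℝ) ≤ n := by exact_mod_cast hn
  have : (0:ℝ) ≤ k := by positivity
  linarith

lemma gamma_num_pos (n k : ℕ) (hn : 1 ≤ n) :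
    0 < Real.Gamma ((2 * (k:ℝ) + n - 1 + 1) / 4) := by
  apply Real.Gamma_pos_of_pos
  have : (1:ℝ) ≤ n := by exact_mod_cast hn
  have : (0:ℝ) ≤ k := by positivity
  linarith

lemma abs_coefC (n k : ℕ) (hn : 1 ≤ n) : |coefC n k| =
    (2:ℝ) ^ (-((2 * k : ℝ) + ((n : ℝ) - 2) / 2)) /
    (Nat.factorial k * Real.Gamma ((k : ℝ) + ((n : ℝ) - 2) / 2 + 1)) *
      (1 / 4 * Real.Gamma ((2 * (k:ℝ) + n - 1 + 1) / 4)) := by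
  have h1 := gamma_den_pos n k hn
  have h2 := gamma_num_pos n k hn
  unfold coefC coefA
  rw [abs_mul, abs_div, abs_mul, abs_pow, abs_neg, abs_one, one_pow, one_mul,
    abs_of_pos (a := (2:ℝ) ^ _) (by positivity), abs_of_pos (a := _ * Real.Gamma _) (by positivity),
    abs_of_pos (a := _ * Real.Gamma _) (by positivity)]

lemma summable_coefC (n : ℕ) (hn : 1 ≤ n) (η : ℝ) :
    Summable (fun k : ℕ => |coefC n k| * (η ^ (2 * k))) := by
  have hs : Summable (fun k : ℕ => 2 * ((η^2) ^ k / (Nat.factorial k : ℝ))) :=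
    (Real.summable_pow_div_factorial (η^2)).mul_left 2
  refine Summable.of_norm_bounded_eventually_nat hs ?_
  filter_upwards [eventually_ge_atTop 4] with k hk
  have hn' : (1:ℝ) ≤ n := by exact_mod_cast hn
  have hk' : (4:ℝ) ≤ k := by exact_mod_cast hk
  have hG1 := gamma_den_pos n k hn
  have hG : Real.Gamma ((2 * (k:ℝ) + n - 1 + 1) / 4) ≤
      Real.Gamma ((k : ℝ) + ((n : ℝ) - 2) / 2 + 1) := by
    apply Real.Gamma_strictMonoOn_Ici.monotoneOn
    · simp only [Set.mem_Ici]; linarith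
    · simp only [Set.mem_Ici]; linarith
    · linarith
  have h2 : (2:ℝ) ^ (-((2 * k : ℝ) + ((n : ℝ) - 2) / 2)) ≤ 1 := by
    apply Real.rpow_le_one_of_one_le_of_nonpos (by norm_num); linarith
  have h3 : (0:ℝ) < (2:ℝ) ^ (-((2 * k : ℝ) + ((n : ℝ) - 2) / 2)) := by positivity
  have hf : (0:ℝ) < Nat.factorial k := by positivity
  have hη : 0 ≤ η ^ (2*k) := by rw [pow_mul]; positivity
  rw [Real.norm_of_nonneg (mul_nonneg (abs_nonneg _) hη), abs_coefC n k hn, pow_mul]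
  set G := Real.Gamma ((k : ℝ) + ((n : ℝ) - 2) / 2 + 1)
  set G' := Real.Gamma ((2 * (k:ℝ) + n - 1 + 1) / 4)
  have : (2:ℝ) ^ (-((2 * k : ℝ) + ((n : ℝ) - 2) / 2)) / (Nat.factorial k * G) * (1/4 * G')
      ≤ 1 / (Nat.factorial k * G) * (2 * G) := by
    have hG' : 0 < G' := gamma_num_pos n k hn
    gcongr
    norm_num
  calc _ ≤ 1 / (Nat.factorial k * G) * (2 * G) * (η^2)^k := by gcongr
    _ = _ := by field_simp

lemma fterm_eq (n k : ℕ) (η s : ℝ) (hη : 0 < η) (hs : 0 < s) :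
    Real.exp (-(s ^ (2 * 2))) * (η * s) ^ ((n : ℝ) / 2) *
      ((-1 : ℝ) ^ k * ((η * s) / 2) ^ ((2 * k : ℝ) + ((n : ℝ) - 2) / 2) /
    (Nat.factorial k * Real.Gamma ((k : ℝ) + ((n : ℝ) - 2) / 2 + 1))) =
    (coefA n k * η ^ ((n:ℝ) - 1) * η ^ (2 * k)) *
      (s ^ (2 * (k:ℝ) + n - 1) * Real.exp (- s ^ (4:ℝ))) := by
  have h4 : s ^ (4:ℝ) = s ^ (2*2) := by
    rw [← Real.rpow_natCast]; norm_num
  have hx : ∀ x : ℝ, 0 < x → x ^ (2 * (k:ℝ) + n - 1) =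
      x ^ ((n : ℝ) / 2) * x ^ ((2 * k : ℝ) + ((n : ℝ) - 2) / 2) := by
    intro x hx
    rw [← Real.rpow_add hx]; congr 1; ring
  have he : η ^ ((n:ℝ) - 1) * η ^ (2 * k) = η ^ (2 * (k:ℝ) + n - 1) := by
    rw [← Real.rpow_natCast η (2*k), ← Real.rpow_add hη]; congr 1; push_cast; ring
  rw [h4, mul_assoc (coefA n k), he, hx η hη, hx s hs, Real.div_rpow (by positivity) (by norm_num),
    Real.mul_rpow hη.le hs.le, Real.mul_rpow hη.le hs.le]
  unfold coefA
  rw [Real.rpow_neg (by norm_num)]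
  ring

lemma fmn_eq (n : ℕ) (hn : 1 ≤ n) (η : ℝ) (hη : 0 < η) :
    fmn 2 n η = ∑' k : ℕ, coefC n k * η ^ (2 * k) := by
  have hn' : (1:ℝ) ≤ n := by exact_mod_cast hn
  have hq : ∀ k : ℕ, (-1:ℝ) < 2 * (k:ℝ) + n - 1 := by
    intro k
    have : (0:ℝ) ≤ k := by positivity
    linarith
  set μ := volume.restrict (Set.Ioi (0:ℝ))
  let F : ℕ → ℝ → ℝ := fun k s => (coefA n k * η ^ ((n:ℝ) - 1) * η ^ (2 * k)) *
      (s ^ (2 * (k:ℝ) + n - 1) * Real.exp (- s ^ (4:ℝ)))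
  have hint0 : ∀ k : ℕ, ∫ s in Set.Ioi (0:ℝ), s ^ (2 * (k:ℝ) + n - 1) * Real.exp (- s ^ (4:ℝ))
      = 1 / 4 * Real.Gamma ((2 * (k:ℝ) + n - 1 + 1) / 4) := fun k =>
    integral_rpow_mul_exp_neg_rpow (by norm_num) (hq k)
  have hI : ∀ k, Integrable (F k) μ := fun k =>
    (integrableOn_rpow_mul_exp_neg_rpow (hq k) (by norm_num)).const_mul _
  have hF : ∀ k, ∫ s, F k s ∂μ = η ^ ((n:ℝ) - 1) * (coefC n k * η ^ (2*k)) := by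
    intro k
    simp only [F, μ]
    rw [integral_const_mul, hint0 k, coefC]
    ring
  have hN : ∀ k, ∫ s, ‖F k s‖ ∂μ = η ^ ((n:ℝ) - 1) * (|coefC n k| * η ^ (2*k)) := by
    intro k
    have : ∫ s, ‖F k s‖ ∂μ = ∫ s, |coefA n k * η ^ ((n:ℝ) - 1) * η ^ (2 * k)| *
      (s ^ (2 * (k:ℝ) + n - 1) * Real.exp (- s ^ (4:ℝ))) ∂μ := by
      apply setIntegral_congr_fun measurableSet_Ioi
      intro s hs
      have hs : 0 < s := hs
      simp only [F]
      rw [Real.norm_eq_abs, abs_mul, abs_of_pos (a := s ^ _ * _) (by positivity)]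
    rw [this, integral_const_mul, hint0 k, coefC, abs_mul (coefA n k),
      abs_of_pos (a := 1/4 * _) (by have := gamma_num_pos n k hn; positivity), abs_mul, abs_mul,
      abs_of_pos (a := η ^ ((n:ℝ) - 1)) (by positivity), abs_of_pos (a := η ^ (2*k)) (by positivity)]
    ring
  have hS : Summable (fun k => ∫ s, ‖F k s‖ ∂μ) := by
    simp only [hN]
    exact (summable_coefC n hn η).mul_left _
  have key := integral_tsum_of_summable_integral_norm hI hS
  have hcong : ∫ s in Set.Ioi (0 : ℝ),
      Real.exp (-(s ^ (2 * 2))) * (η * s) ^ ((n : ℝ) / 2) *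
        besselJ (((n : ℝ) - 2) / 2) (η * s) = ∫ s, ∑' k, F k s ∂μ := by
    apply setIntegral_congr_fun measurableSet_Ioi
    intro s hs
    have hs : 0 < s := hs
    simp only [besselJ, F]
    rw [← tsum_mul_left]
    exact tsum_congr fun k => fterm_eq n k η s hη hs
  unfold fmn
  rw [hcong, ← key]
  simp only [hF]
  rw [tsum_mul_left, ← mul_assoc, ← Real.rpow_add hη]
  simp

lemma coefC_even (j : ℕ) (hj : 1 ≤ j) (k : ℕ) : coefC (2 * j) k =
    (-1 : ℝ) ^ k * Real.Gamma (((k : ℝ) + j) / 2) /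
          (2 ^ (2 * k + j + 1) * Nat.factorial k * Nat.factorial (k + j - 1)) := by
  obtain ⟨i, rfl⟩ : ∃ i, j = i + 1 := ⟨j - 1, by omega⟩
  have h1 : (k : ℝ) + (((2 * (i+1) : ℕ) : ℝ) - 2) / 2 + 1 = ((k + i : ℕ) : ℝ) + 1 := by
    push_cast; ring
  have h2 : (2 * (k:ℝ) + ((2 * (i+1) : ℕ):ℝ) - 1 + 1) / 4 = ((k:ℝ) + ((i + 1 : ℕ) : ℝ)) / 2 := by
    push_cast; ring
  have h3 : (2 * k : ℝ) + (((2 * (i+1) : ℕ) : ℝ) - 2) / 2 = ((2 * k + i : ℕ) : ℝ) := by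
    push_cast; ring
  unfold coefC coefA
  rw [h1, h2, h3, Real.Gamma_nat_eq_factorial, Real.rpow_neg (by norm_num), Real.rpow_natCast,
    show k + (i + 1) - 1 = k + i by omega, show 2 * k + (i + 1) + 1 = 2 * k + i + 2 by ring,
    pow_add 2 (2*k+i) 2]
  field_simp
  norm_num

lemma gamma_half (N : ℕ) : Real.Gamma ((N:ℝ) + 1/2) =
    (Nat.factorial (2 * N)) * √π / (4 ^ N * Nat.factorial N) := by
  induction N with
  | zero => simp [Real.Gamma_one_half_eq, -one_div]
  | succ N ih =>
    have : ((N + 1 : ℕ) : ℝ) + 1/2 = ((N:ℝ) + 1/2) + 1 := by push_cast; ring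
    rw [this, Real.Gamma_add_one (by positivity), ih, show 2 * (N+1) = 2 * N + 1 + 1 by ring,
      Nat.factorial_succ, Nat.factorial_succ, Nat.factorial_succ]
    push_cast
    field_simp
    ring

lemma coefC_odd (j : ℕ) (k : ℕ) : coefC (2 * j + 1) k =
    2 ^ j / Real.sqrt (8 * π) * ((-1 : ℝ) ^ k * Nat.factorial (k + j) *
            Real.Gamma ((2 * (k : ℝ) + 2 * j + 1) / 4) /
              (Nat.factorial k * Nat.factorial (2 * k + 2 * j))) := by
  have h1 : (k : ℝ) + (((2 * j + 1 : ℕ) : ℝ) - 2) / 2 + 1 = ((k + j : ℕ) : ℝ) + 1/2 := by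
    push_cast; ring
  have h2 : (2 * (k:ℝ) + ((2 * j + 1 : ℕ):ℝ) - 1 + 1) / 4 = (2 * (k : ℝ) + 2 * j + 1) / 4 := by
    push_cast; ring
  have h3 : -((2 * k : ℝ) + (((2 * j + 1 : ℕ) : ℝ) - 2) / 2) = 1/2 - ((2 * k + j : ℕ) : ℝ) := by
    push_cast; ring
  have h8 : √(8 * π) = 2 * √2 * √π := by
    rw [Real.sqrt_mul (by norm_num), show (8:ℝ) = 2^2 * 2 by norm_num, Real.sqrt_mul (by norm_num),
      Real.sqrt_sq (by norm_num)]
  have hpi : 0 < √π := Real.sqrt_pos.mpr Real.pi_pos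
  have hs2 : √(2:ℝ) ^ 2 = 2 := Real.sq_sqrt (by norm_num)
  unfold coefC coefA
  rw [h1, h2, h3, gamma_half, Real.rpow_sub (by norm_num), Real.rpow_natCast, ← Real.sqrt_eq_rpow,
    h8, show 2 * (k + j) = 2 * k + 2 * j by ring, show (4:ℝ) = 2^2 by norm_num, ← pow_mul,
    show 2 * (k + j) = (2 * k + j) + j by ring, pow_add 2 (2*k+j) j]
  field_simp
  rw [hs2]

lemma fmn_tendsto (n : ℕ) (hn : 1 ≤ n) :
    Tendsto (fmn 2 n) (nhdsWithin 0 (Set.Ioi 0)) (nhds (coefC n 0)) := by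
  have h0 : (∑' k : ℕ, coefC n k * (0:ℝ) ^ (2 * k)) = coefC n 0 := by
    rw [tsum_eq_single 0]
    · simp
    · intro k hk; simp [hk]
  have hs : Summable (fun k => |coefC n k|) := by simpa using summable_coefC n hn 1
  have : Tendsto (fun η : ℝ => ∑' k : ℕ, coefC n k * η ^ (2 * k)) (nhdsWithin 0 (Set.Ioi 0))
      (nhds (∑' k : ℕ, coefC n k * (0:ℝ) ^ (2 * k))) := by
    refine tendsto_tsum_of_dominated_convergence hs ?_ ?_
    · intro k
      have : Continuous (fun η : ℝ => coefC n k * η ^ (2*k)) := by fun_prop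
      exact (this.tendsto 0).mono_left nhdsWithin_le_nhds
    · filter_upwards [Ioo_mem_nhdsGT (show (0:ℝ) < 1 by norm_num)] with η hη k
      rw [norm_mul, Real.norm_eq_abs, norm_pow, Real.norm_eq_abs, abs_of_pos hη.1]
      exact mul_le_of_le_one_right (abs_nonneg _) (pow_le_one₀ hη.1.le hη.2.le)
  rw [h0] at this
  refine this.congr' ?_
  filter_upwards [self_mem_nhdsWithin] with η hη
  exact (fmn_eq n hn η hη).symm

/-- power series representations of the biharmonic heat kernel profiles
`f_{2j}` and `f_{2j+1}`, and existence and positivity of the limit `f_n(0⁺)`. -/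
theorem biharmonic_kernel_power_series :
    (∀ j : ℕ, 1 ≤ j → ∀ η : ℝ, 0 < η →
      fmn 2 (2 * j) η =
        ∑' k : ℕ, (-1 : ℝ) ^ k * Real.Gamma (((k : ℝ) + j) / 2) /
          (2 ^ (2 * k + j + 1) * Nat.factorial k * Nat.factorial (k + j - 1)) * η ^ (2 * k)) ∧
    (∀ j : ℕ, ∀ η : ℝ, 0 < η →
      fmn 2 (2 * j + 1) η =
        2 ^ j / Real.sqrt (8 * π) *
          ∑' k : ℕ, (-1 : ℝ) ^ k * Nat.factorial (k + j) *
            Real.Gamma ((2 * (k : ℝ) + 2 * j + 1) / 4) /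
              (Nat.factorial k * Nat.factorial (2 * k + 2 * j)) * η ^ (2 * k)) ∧
    (∀ n : ℕ, 1 ≤ n → ∃ L : ℝ, 0 < L ∧
      Tendsto (fmn 2 n) (nhdsWithin 0 (Set.Ioi 0)) (nhds L)) := by
  refine ⟨fun j hj η hη => ?_, fun j η hη => ?_, fun n hn => ⟨coefC n 0, ?_, fmn_tendsto n hn⟩⟩
  · rw [fmn_eq _ (by omega) η hη]
    exact tsum_congr fun k => by rw [coefC_even j hj k]
  · rw [fmn_eq _ (by omega) η hη, ← tsum_mul_left]
    exact tsum_congr fun k => by rw [coefC_odd j k, mul_assoc]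
  · have h1 := gamma_den_pos n 0 hn
    have h2 := gamma_num_pos n 0 hn
    unfold coefC coefA
    rw [pow_zero, one_mul]
    positivity
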